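/- Let S = {1,…,N} and 𝒦 = {1,…,K} be nonempty finite index sets, let A_i be real n×n and B_i real n×m matrices (i ∈ S), and for each κ ∈ 𝒦 let (λ_{ij}^κ) be a transition rate matrix: λ_{ij}^κ ≥ 0 for i ≠ j and λ_{ii}^κ = −Σ_{j≠i} λ_{ij}^κ. Suppose there exist real symmetric positive definite n×n matrices X_i and real m×n matrices Y_i (i ∈ S) such that for every i ∈ S and κ ∈ 𝒦 the symmetric block matrix [ J_i , ℳ_{κi} ; ℳ_{κi}ᵀ , −𝒳_i ] is negative definite, where J_i = X_i A_iᵀ + Y_iᵀ B_iᵀ + A_i X_i + B_i Y_i + λ_{ii}^κ X_i, ℳ_{κi} is the row of blocks [√(λ_{i1}^κ) X_i, …, √(λ_{i,i−1}^κ) X_i, √(λ_{i,i+1}^κ) X_i, …, √(λ_{iN}^κ) X_i], and 𝒳_i = diag{X_1, …, X_{i−1}, X_{i+1}, …, X_N}. Then, setting K_i = Y_i X_i⁻¹, P_i = X_i⁻¹ and Ã_i = A_i + B_i K_i, each P_i is symmetric positive definite and for every i ∈ S, κ ∈ 𝒦 the matrix Ã_iᵀ P_i + P_i Ã_i + Σ_{j=1}^N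 λ_{ij}^κ P_j is negative definite. -/

import Mathlib

open Matrix Finset

/-- A block form of congruence: testing a positive definite block matrix against the range of
`fromRows P C`, with `P` injective, gives a positive definite matrix. -/
theorem Matrix.PosDef.fromRows_congruence {p q r : Type*} [Fintype p] [Fintype q] [Fintype r]
    {J : Matrix p p ℝ} {M : Matrix p q ℝ} {D : Matrix q q ℝ}
    (h : (fromBlocks J M Mᵀ D).PosDef) {P : Matrix p r ℝ}
    (hP : Function.Injective P.mulVec) (C : Matrix q r ℝ) :
    (Pᵀ * J * P + Pᵀ * (M * C) + ((M * C)ᵀ * P + Cᵀ * D * C)).PosDef := by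
  have hinj : Function.Injective (fromRows P C).mulVec := by
    intro x y hxy
    simp only [fromRows_mulVec] at hxy
    exact hP (funext fun a => congrFun hxy (Sum.inl a))
  have key := h.conjTranspose_mul_mul_same hinj
  rw [conjTranspose_eq_transpose_of_trivial, transpose_fromRows, fromCols_mul_fromBlocks,
    fromCols_mul_fromRows] at key
  convert key using 1
  simp only [transpose_mul, Matrix.add_mul, Matrix.mul_assoc]
  abel

/-- A row of blocks times a column of blocks is the sum of the products of the blocks. -/
theorem blockRow_mul_blockCol {n ι R l k : Type*} [Fintype n] [Fintype ι] [NonUnitalSemiring R]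
    (U : ι → Matrix l n R) (V : ι → Matrix n k R) :
    (of fun a (p : n × ι) => U p.2 a p.1) * (of fun (p : n × ι) b => V p.2 p.1 b) =
      ∑ j, U j * V j := by
  ext a b
  simp [mul_apply, Matrix.sum_apply, Fintype.sum_prod_type_right]

/-- A block diagonal matrix acts blockwise on a column of blocks. -/
theorem blockDiagonal_mul_blockCol {n ι R k : Type*} [Fintype n] [Fintype ι] [DecidableEq ι]
    [NonUnitalNonAssocSemiring R] (D : ι → Matrix n n R) (V : ι → Matrix n k R) :
    blockDiagonal D * (of fun (p : n × ι) b => V p.2 p.1 b) =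
      of fun (p : n × ι) b => (D p.2 * V p.2) p.1 b := by
  ext ⟨a, i⟩ b
  simp [mul_apply, blockDiagonal_apply, Fintype.sum_prod_type_right, ite_mul, sum_ite_irrel]

/-- Matrix-analytic content of the stochastic stabilization theorem: feasibility of the
stabilization LMIs
`[ J_i , ℳ_{κi} ; ℳ_{κi}ᵀ , −𝒳_i ] ≺ 0` (with `J_i = X_i A_iᵀ + Y_iᵀ B_iᵀ + A_i X_i +
B_i Y_i + λ_{ii}^κ X_i`, `ℳ_{κi}` built of the blocks `√(λ_{ij}^κ) X_i` for `j ≠ i`, and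
`𝒳_i = diag{X_j : j ≠ i}`) yields, with `K_i = Y_i X_i⁻¹`, `P_i = X_i⁻¹` and
`Ã_i = A_i + B_i K_i`, that each `P_i ≻ 0` and each coupled closed-loop Lyapunov matrix
`Ã_iᵀ P_i + P_i Ã_i + Σ_j λ_{ij}^κ P_j` is negative definite. -/
theorem stabilization_lmi_implies_coupled_lyapunov
    {n m N K : ℕ} (hN : 0 < N) (hK : 0 < K)
    (A : Fin N → Matrix (Fin n) (Fin n) ℝ)
    (B : Fin N → Matrix (Fin n) (Fin m) ℝ)
    (Λ : Fin K → Fin N → Fin N → ℝ)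
    (hΛoff : ∀ κ i j, i ≠ j → 0 ≤ Λ κ i j)
    (hΛdiag : ∀ κ i, Λ κ i i = -∑ j ∈ univ \ {i}, Λ κ i j)
    (X : Fin N → Matrix (Fin n) (Fin n) ℝ) (hX : ∀ i, (X i).PosDef)
    (Y : Fin N → Matrix (Fin m) (Fin n) ℝ)
    (hLMI : ∀ (i : Fin N) (κ : Fin K),
      (-(Matrix.fromBlocks
          (X i * (A i)ᵀ + (Y i)ᵀ * (B i)ᵀ + A i * X i + B i * Y i + Λ κ i i • X i)
          (Matrix.of fun a p => Real.sqrt (Λ κ i p.2.1) * X i a p.1)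
          (Matrix.of fun (a : Fin n) (p : Fin n × {j : Fin N // j ≠ i}) =>
            Real.sqrt (Λ κ i p.2.1) * X i a p.1)ᵀ
          (Matrix.blockDiagonal fun j : {j : Fin N // j ≠ i} => -(X j.1)))).PosDef)
    (Kgain : Fin N → Matrix (Fin m) (Fin n) ℝ) (hKgain : ∀ i, Kgain i = Y i * (X i)⁻¹)
    (P : Fin N → Matrix (Fin n) (Fin n) ℝ) (hP : ∀ i, P i = (X i)⁻¹)
    (Atil : Fin N → Matrix (Fin n) (Fin n) ℝ)
    (hAtil : ∀ i, Atil i = A i + B i * Kgain i) :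
    (∀ i, (P i).PosDef) ∧
      ∀ (i : Fin N) (κ : Fin K),
        (-((Atil i)ᵀ * P i + P i * Atil i + ∑ j, Λ κ i j • P j)).PosDef := by
  have hPpos : ∀ i, (P i).PosDef := fun i => hP i ▸ (hX i).inv
  refine ⟨hPpos, fun i κ => ?_⟩
  have hPX : ∀ j, P j * X j = 1 := fun j =>
    hP j ▸ nonsing_inv_mul _ ((isUnit_iff_isUnit_det _).1 (hX j).isUnit)
  have hXP : ∀ j, X j * P j = 1 := fun j => mul_eq_one_comm.1 (hPX j)
  have hPt : ∀ j, (P j)ᵀ = P j := fun j => (hPpos j).isHermitian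
  have hsq : ∀ j : {j : Fin N // j ≠ i}, √(Λ κ i j) * √(Λ κ i j) = Λ κ i j := fun j =>
    Real.mul_self_sqrt (hΛoff κ i j j.2.symm)
  have hinj : Function.Injective (P i).mulVec :=
    mulVec_injective_of_isUnit (hPpos i).isUnit
  set S := ∑ j : {j : Fin N // j ≠ i}, Λ κ i j • P j with hS
  have hSt : Sᵀ = S := by simp [hS, transpose_sum, hPt]
  let C : Matrix (Fin n × {j : Fin N // j ≠ i}) (Fin n) ℝ :=
    of fun p b => (√(Λ κ i p.2) • P p.2) p.1 b
  have hMC : (of fun (a : Fin n) (p : Fin n × {j : Fin N // j ≠ i}) =>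
      √(Λ κ i p.2.1) * X i a p.1) * C = X i * S := by
    refine (blockRow_mul_blockCol (fun j : {j : Fin N // j ≠ i} => √(Λ κ i j) • X i)
      (fun j => √(Λ κ i j) • P j)).trans ?_
    simp [hS, Matrix.mul_sum, smul_smul, hsq]
  have hCDC : Cᵀ * blockDiagonal (fun j : {j : Fin N // j ≠ i} => -X j.1) * C = -S := by
    rw [Matrix.mul_assoc, blockDiagonal_mul_blockCol (fun j : {j : Fin N // j ≠ i} => -X j.1)
      (fun j => √(Λ κ i j) • P j)]
    refine (blockRow_mul_blockCol (fun j : {j : Fin N // j ≠ i} => (√(Λ κ i j) • P j)ᵀ)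
      (fun j => -X j * (√(Λ κ i j) • P j))).trans ?_
    simp [hS, smul_smul, hsq, hPt, hXP]
  have hblock := hLMI i κ
  rw [fromBlocks_neg, ← transpose_neg] at hblock
  have key := hblock.fromRows_congruence hinj C
  convert key using 1
  simp only [Matrix.mul_neg, Matrix.neg_mul, hMC, hCDC, transpose_neg, transpose_mul, hSt, hPt,
    Matrix.mul_add, Matrix.add_mul, Matrix.mul_assoc]
  have hXt : (X i)ᵀ = X i := (hX i).isHermitian
  have hPXc : ∀ Z : Matrix (Fin n) (Fin n) ℝ, P i * (X i * Z) = Z := fun Z => by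
    rw [← Matrix.mul_assoc, hPX, Matrix.one_mul]
  rw [Fintype.sum_eq_add_sum_subtype_ne (fun j => Λ κ i j • P j) i, ← hS, hAtil, hKgain, ← hP]
  simp only [transpose_add, transpose_mul, hPt, hXt, hXP, hPXc, Matrix.mul_add, Matrix.add_mul,
    Matrix.mul_assoc, Matrix.mul_one, Matrix.smul_mul, Matrix.mul_smul]
  abel
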